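/- The set of subfields F of the algebraic closure of ℚ that are PAC, i.e., such that every absolutely irreducible polynomial f ∈ F[X,Y] has a zero in F × F, is dense in the space 𝓔 of all subfields of the algebraic closure of ℚ. -/

import Mathlib

open FirstOrder Topology

noncomputable section

/-- `Q̄`, the algebraic closure of `ℚ`. -/
abbrev Qbar : Type := AlgebraicClosure ℚ

/-- `Prop` with the discrete two-point topology. -/
def propDiscrete : TopologicalSpace Prop := ⊥

/-- The product topology on the powerset `2^Q̄`, identified with `Set Q̄ = Q̄ → Prop`,
where each factor `Prop` carries the discrete two-point topology. -/
def powersetTopology : TopologicalSpace (Set Qbar) :=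
  @Pi.topologicalSpace Qbar (fun _ => Prop) (fun _ => propDiscrete)

/-- The space `𝓔` of all subfields of `Q̄`, with the subspace topology induced from `2^Q̄`
via the identification of a subfield with its underlying set of elements. -/
instance subfieldTopology : TopologicalSpace (Subfield Qbar) :=
  powersetTopology.induced (fun F => (F : Set Qbar))

/-- A subfield `F` of `Q̄` is PAC if every polynomial `f ∈ F[X,Y]` that is absolutely
irreducible (i.e. whose image in `Q̄[X,Y]` is irreducible) has a zero `(x,y) ∈ F × F`. -/
def IsPAC (F : Subfield Qbar) : Prop :=
  ∀ f : MvPolynomial (Fin 2) F,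
    Irreducible (MvPolynomial.map F.subtype f) →
    ∃ x y : F, MvPolynomial.eval ![x, y] f = 0

open Polynomial

theorem exists_hensel_approx (H : ℤ[X][X]) (p x₀ y₀ w : ℤ)
    (hw : p ∣ w * (derivative H).evalEval x₀ y₀ - 1) (n : ℕ) :
    ∃ Φ : ℤ[X], ∀ t y : ℤ, p ∣ t → p ∣ y - y₀ → H.evalEval (x₀ + t) y = 0 →
      p ^ (n + 1) ∣ Φ.eval t - y := by
  induction n with
  | zero =>
    refine ⟨C y₀, fun t y _ hy _ => ?_⟩
    simpa using (dvd_sub_comm.1 hy)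
  | succ n ih =>
    obtain ⟨Φ, hΦ⟩ := ih
    refine ⟨Φ - C w * H.eval₂ (compRingHom (X + C x₀)) Φ, fun t y ht hy h0 => ?_⟩
    have hG : (H.eval₂ (compRingHom (X + C x₀)) Φ).eval t = H.evalEval (x₀ + t) (Φ.eval t) := by
      rw [← coe_evalRingHom, hom_eval₂, ← eval_map, coe_evalRingHom, ← map_evalRingHom_eval]
      congr 2
      ext <;> simp [add_comm]
    obtain ⟨δ, hδ⟩ := hΦ t y ht hy h0
    have hΦt : Φ.eval t = y + p ^ (n + 1) * δ := by linarith
    obtain ⟨k, hk⟩ := binomExpansion (H.map (evalRingHom (x₀ + t))) y (p ^ (n + 1) * δ)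
    rw [derivative_map, map_evalRingHom_eval, map_evalRingHom_eval, map_evalRingHom_eval, h0] at hk
    have h1 : p ∣ (derivative H).evalEval (x₀ + t) y - (derivative H).evalEval x₀ y₀ := by
      have a1 : p ∣ (derivative H).evalEval (x₀ + t) y - (derivative H).evalEval x₀ y := by
        refine ht.trans ?_
        have := sub_dvd_eval_sub (x₀ + t) x₀ ((derivative H).eval (C y))
        simpa [evalEval] using this
      have a2 : p ∣ (derivative H).evalEval x₀ y - (derivative H).evalEval x₀ y₀ := by
        refine hy.trans ?_
        rw [← map_evalRingHom_eval, ← map_evalRingHom_eval]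
        exact sub_dvd_eval_sub _ _ _
      simpa using dvd_add a1 a2
    obtain ⟨m, hm⟩ := h1
    obtain ⟨s, hs⟩ := hw
    have hm' : (derivative H).evalEval (x₀ + t) y = (derivative H).evalEval x₀ y₀ + p * m := by
      linarith
    rw [eval_sub, eval_mul, eval_C, hG, hΦt, hk, hm']
    refine ⟨-δ * (s + w * m) - w * k * δ ^ 2 * p ^ n, ?_⟩
    linear_combination (-p ^ (n + 1) * δ) * hs

theorem exists_small_linear (p : ℕ) (hp : 1 < p) (q : ℕ) (hq : 0 < q) (Φ : ℤ[X]) :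
    ∃ A B : ℤ[X], (A ≠ 0 ∨ B ≠ 0) ∧ A.degree < (4 * q : ℕ) ∧ B.degree < (4 * q : ℕ) ∧
      (∀ i, |A.coeff i| ≤ (p : ℤ) ^ (3 * q)) ∧ (∀ i, |B.coeff i| ≤ (p : ℤ) ^ (3 * q)) ∧
      ∀ u : ℤ, (p : ℤ) ^ (4 * q) ∣ A.eval u + B.eval u * Φ.eval (p * u) := by
  classical
  set r := 4 * q with hr
  set N := p ^ (3 * q) with hN
  have hp0 : 0 < p := by omega
  let w : ℕ → ℕ := fun l => l + 1 - r
  let P : (Fin r → Fin N) → ℤ[X] := fun a => ∑ i : Fin r, C ((a i : ℕ) : ℤ) * X ^ (i : ℕ)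
  have hPc : ∀ a l, (P a).coeff l = if h : l < r then (((a ⟨l, h⟩ : Fin N) : ℕ) : ℤ) else 0 := by
    intro a l
    simp only [P, finsetSum_coeff, coeff_C_mul, coeff_X_pow]
    split_ifs with h
    · rw [Finset.sum_eq_single ⟨l, h⟩]
      · simp
      · intro b _ hb
        have : l ≠ b := fun h' => hb (Fin.ext h'.symm)
        simp [this]
      · simp
    · refine Finset.sum_eq_zero fun b _ => ?_
      have : l ≠ b := by have := b.2; omega
      simp [this]
  let Q : (Fin r → Fin N) × (Fin r → Fin N) → ℤ[X] :=
    fun a => P a.1 + P a.2 * Φ.comp (C (p : ℤ) * X)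
  have hQ : ∀ a l, (p : ℤ) ^ w l ∣ (Q a).coeff l := by
    intro a l
    simp only [Q, coeff_add, coeff_mul, comp_C_mul_X_coeff]
    refine dvd_add ?_ (Finset.dvd_sum fun m hm => ?_)
    · rw [hPc]
      split_ifs with h
      · have : w l = 0 := by simp only [w]; omega
        simp [this]
      · simp
    · rw [hPc]
      split_ifs with h
      · have : w l ≤ m.2 := by
          have := Finset.HasAntidiagonal.mem_antidiagonal.1 hm
          simp only [w]; omega
        exact Dvd.dvd.mul_left (Dvd.dvd.mul_left (pow_dvd_pow _ this) _) _
      · simp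
  have : ∀ l, NeZero (p ^ (r - w l)) := fun l => ⟨by positivity⟩
  let F : (Fin r → Fin N) × (Fin r → Fin N) → ∀ l : Fin (2 * r), ZMod (p ^ (r - w l)) :=
    fun a l => (((Q a).coeff l / (p : ℤ) ^ w l : ℤ) : ZMod (p ^ (r - w l)))
  have hcard : Fintype.card (∀ l : Fin (2 * r), ZMod (p ^ (r - w l))) <
      Fintype.card ((Fin r → Fin N) × (Fin r → Fin N)) := by
    simp only [Fintype.card_pi, ZMod.card, Fintype.card_prod, Fintype.card_fin, Finset.prod_const,
      Finset.card_univ]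
    rw [Finset.prod_pow_eq_pow_sum, hN, ← pow_mul, ← pow_add]
    refine Nat.pow_lt_pow_right hp ?_
    have e1 : ∑ l : Fin (2 * r), (r - w l) = ∑ l ∈ Finset.range (2 * r), (r - w l) :=
      Fin.sum_univ_eq_sum_range (fun l => r - w l) (2 * r)
    rw [e1, two_mul, Finset.sum_range_add]
    have e2 : ∑ x ∈ Finset.range r, (r - w x) = r * r := by
      rw [Finset.sum_congr rfl (g := fun _ => r)]
      · simp
      · intro x hx
        have := Finset.mem_range.1 hx
        simp only [w]; omega
    have e3 : ∑ x ∈ Finset.range r, (r - w (r + x)) = ∑ x ∈ Finset.range r, x := by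
      rw [← Finset.sum_range_reflect]
      refine Finset.sum_congr rfl fun x hx => ?_
      have := Finset.mem_range.1 hx
      simp only [w]; omega
    have e4 := Finset.sum_range_id_mul_two r
    rw [e2, e3]
    obtain ⟨q', rfl⟩ : ∃ q', q = q' + 1 := ⟨q - 1, by omega⟩
    have : r - 1 = 4 * q' + 3 := by omega
    rw [this] at e4
    rw [hr] at e4 ⊢
    nlinarith
  obtain ⟨a, b, hab, hF⟩ := Fintype.exists_ne_map_eq_of_card_lt F hcard
  have hdeg : ∀ a b, (P a - P b).degree < (r : ℕ) := by
    intro a b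
    rw [degree_lt_iff_coeff_zero]
    intro m hm
    simp [hPc, not_lt.2 hm]
  have hco : ∀ a b i, |(P a - P b).coeff i| ≤ (p : ℤ) ^ (3 * q) := by
    intro a b i
    rw [coeff_sub, hPc, hPc]
    split_ifs with h
    · have h1 := (a ⟨i, h⟩).2
      have h2 := (b ⟨i, h⟩).2
      have : (N : ℤ) = (p : ℤ) ^ (3 * q) := by simp [hN]
      rw [← this, abs_le]
      constructor <;> omega
    · simp
  have hPinj : ∀ a b, P a - P b = 0 → a = b := by
    intro a b h
    funext i
    have := congrArg (fun f => f.coeff i) h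
    simp only [coeff_sub, hPc, i.2, dite_true, coeff_zero] at this
    apply Fin.ext
    simp only [Fin.eta] at this
    omega
  refine ⟨P a.1 - P b.1, P a.2 - P b.2, ?_, hdeg _ _, hdeg _ _, hco _ _, hco _ _, ?_⟩
  · by_contra! h
    exact hab (Prod.ext (hPinj _ _ h.1) (hPinj _ _ h.2))
  · intro u
    have hd : C ((p : ℤ) ^ r) ∣ Q a - Q b := by
      rw [C_dvd_iff_dvd_coeff]
      intro l
      rcases lt_or_ge l (2 * r) with hl | hl
      · have h1 := congrFun hF ⟨l, hl⟩
        simp only [F] at h1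
        obtain ⟨s, hs⟩ := hQ a l
        obtain ⟨t, ht⟩ := hQ b l
        have hpw : (p : ℤ) ^ w l ≠ 0 := by positivity
        rw [hs, ht, Int.mul_ediv_cancel_left _ hpw, Int.mul_ediv_cancel_left _ hpw,
          ZMod.intCast_eq_intCast_iff_dvd_sub] at h1
        rw [coeff_sub, hs, ht, ← mul_sub]
        have : r = w l + (r - w l) := by simp only [w]; omega
        rw [this, pow_add]
        push_cast at h1
        exact mul_dvd_mul_left _ ((dvd_sub_comm).1 h1)
      · rw [coeff_sub]
        have : r ≤ w l := by simp only [w]; omega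
        exact dvd_sub ((pow_dvd_pow _ this).trans (hQ a l)) ((pow_dvd_pow _ this).trans (hQ b l))
    obtain ⟨T, hT⟩ := hd
    have := congrArg (eval u) hT
    refine ⟨T.eval u, ?_⟩
    simp only [Q, eval_sub, eval_add, eval_mul, eval_comp, eval_C, eval_X] at this
    simp only [eval_sub]
    linear_combination this

theorem exists_abs_eval_le (f : ℤ[X]) : ∃ C k : ℕ, ∀ x : ℤ, |f.eval x| ≤ C * (1 + |x|) ^ k := by
  refine ⟨∑ i ∈ Finset.range (f.natDegree + 1), (f.coeff i).natAbs, f.natDegree, fun x => ?_⟩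
  rw [eval_eq_sum_range]
  refine (Finset.abs_sum_le_sum_abs _ _).trans ?_
  push_cast
  rw [Finset.sum_mul]
  refine Finset.sum_le_sum fun i hi => ?_
  rw [abs_mul, abs_pow]
  refine mul_le_mul_of_nonneg_left ?_ (abs_nonneg _)
  have h0 := abs_nonneg x
  calc |x| ^ i ≤ (1 + |x|) ^ i := by gcongr; omega
    _ ≤ (1 + |x|) ^ f.natDegree := pow_le_pow_right₀ (by omega) (by
        have := Finset.mem_range.1 hi; omega)

theorem abs_le_of_monic_root {P : ℤ[X]} (hP : P.Monic) {y : ℤ} (hy : P.eval y = 0) :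
    |y| ≤ 1 + ∑ i ∈ Finset.range P.natDegree, |P.coeff i| := by
  have hs : 0 ≤ ∑ i ∈ Finset.range P.natDegree, |P.coeff i| :=
    Finset.sum_nonneg fun i _ => abs_nonneg _
  rcases le_or_gt |y| 1 with h1 | h1
  · linarith
  rcases Nat.eq_zero_or_pos P.natDegree with hd | hd
  · rw [hP.natDegree_eq_zero.1 hd] at hy
    simp at hy
  rw [eval_eq_sum_range, Finset.sum_range_succ, hP.coeff_natDegree, one_mul] at hy
  have h2 : |y| ^ P.natDegree ≤
      (∑ i ∈ Finset.range P.natDegree, |P.coeff i|) * |y| ^ (P.natDegree - 1) := by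
    rw [← abs_pow, eq_neg_of_add_eq_zero_right hy, abs_neg, Finset.sum_mul]
    refine (Finset.abs_sum_le_sum_abs _ _).trans (Finset.sum_le_sum fun i hi => ?_)
    rw [abs_mul, abs_pow]
    have := Finset.mem_range.1 hi
    exact mul_le_mul_of_nonneg_left (pow_le_pow_right₀ h1.le (by omega)) (abs_nonneg _)
  have h3 : |y| ^ P.natDegree = |y| * |y| ^ (P.natDegree - 1) := by
    rw [← pow_succ', Nat.sub_add_cancel hd]
  rw [h3] at h2
  have := le_of_mul_le_mul_right h2 (by positivity)
  linarith

theorem exists_abs_root_le {H : ℤ[X][X]} (hH : H.Monic) :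
    ∃ C k : ℕ, ∀ x y : ℤ, H.evalEval x y = 0 → |y| ≤ C * (1 + |x|) ^ k := by
  choose c k hck using fun i => exists_abs_eval_le (H.coeff i)
  set d := H.natDegree
  refine ⟨1 + ∑ i ∈ Finset.range d, c i, ∑ i ∈ Finset.range d, k i, fun x y h => ?_⟩
  have h0 := abs_nonneg x
  have h1 : ∀ n, 1 ≤ (1 + |x|) ^ n := fun n => one_le_pow₀ (by omega)
  rw [← map_evalRingHom_eval] at h
  refine (abs_le_of_monic_root (hH.map _) h).trans ?_
  rw [hH.natDegree_map]
  push_cast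
  rw [add_mul, one_mul]
  refine add_le_add (h1 _) ?_
  rw [Finset.sum_mul]
  refine Finset.sum_le_sum fun i hi => ?_
  rw [coeff_map, coe_evalRingHom]
  refine (hck i x).trans (mul_le_mul_of_nonneg_left ?_ (by positivity))
  exact pow_le_pow_right₀ (by omega) (Finset.single_le_sum (f := k) (fun _ _ => Nat.zero_le _) hi)

/-- The polynomial `B ^ d * H (x₀ + p u, - A / B)` in the variable `u`. -/
def elimLinear (H : ℤ[X][X]) (x₀ p : ℤ) (A B : ℤ[X]) : ℤ[X] :=
  (scaleRoots (H.map (compRingHom (C p * X + C x₀))) B).eval (-A)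

theorem elimLinear_eval {H : ℤ[X][X]} {x₀ p u y : ℤ} {A B : ℤ[X]}
    (h : H.evalEval (x₀ + p * u) y = 0) (hAB : A.eval u + B.eval u * y = 0) :
    (elimLinear H x₀ p A B).eval u = 0 := by
  have hA : -A.eval u = B.eval u * y := by linarith
  change evalRingHom u (eval₂ (RingHom.id _) (-A) _) = 0
  rw [hom_eval₂, RingHom.comp_id, map_neg, coe_evalRingHom, hA, ← coe_evalRingHom,
    scaleRoots_eval₂_mul, ← eval_map, map_map]
  have : (evalRingHom u).comp (compRingHom (C p * X + C x₀)) = evalRingHom (x₀ + p * u) := by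
    ext <;> simp [add_comm]
  rw [this, map_evalRingHom_eval, h, mul_zero]

theorem elimLinear_natDegree_le {H : ℤ[X][X]} (x₀ p : ℤ) {A B : ℤ[X]} {r : ℕ}
    (hA : A.natDegree ≤ r) (hB : B.natDegree ≤ r) :
    (elimLinear H x₀ p A B).natDegree ≤
      (∑ i ∈ Finset.range (H.natDegree + 1), (H.coeff i).natDegree) + 2 * H.natDegree * r := by
  rw [elimLinear, eval_eq_sum_range' (n := H.natDegree + 1)
    (by rw [natDegree_scaleRoots]; exact Nat.lt_succ_of_le natDegree_map_le)]
  refine natDegree_sum_le_of_forall_le _ _ fun i hi => ?_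
  rw [coeff_scaleRoots, coeff_map]
  have hi' := Finset.mem_range.1 hi
  have h1 : (compRingHom (C p * X + C x₀) (H.coeff i)).natDegree ≤
      ∑ i ∈ Finset.range (H.natDegree + 1), (H.coeff i).natDegree := by
    rw [coe_compRingHom_apply]
    refine natDegree_comp_le.trans ?_
    refine (Nat.mul_le_mul_left _ (natDegree_linear_le)).trans ?_
    rw [mul_one]
    exact Finset.single_le_sum (f := fun i => (H.coeff i).natDegree) (fun _ _ => Nat.zero_le _) hi
  have h2 : (-A).natDegree ≤ r := by rwa [natDegree_neg]
  have h3 : (map (compRingHom (C p * X + C x₀)) H).natDegree ≤ H.natDegree := natDegree_map_le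
  refine natDegree_mul_le.trans ?_
  refine (add_le_add (natDegree_mul_le.trans (add_le_add h1
    (natDegree_pow_le_of_le _ hB))) (natDegree_pow_le_of_le _ h2)).trans ?_
  rw [add_assoc]
  refine Nat.add_le_add_left ?_ _
  rw [two_mul, add_mul]
  exact add_le_add (Nat.mul_le_mul_right _ (by omega)) (Nat.mul_le_mul_right _ (by omega))

theorem elimLinear_ne_zero {k : Type*} [Field k] {ι : ℤ[X] →+* k} (hι : Function.Injective ι)
    {H : ℤ[X][X]} (hH : H.Monic) (hd : 2 ≤ H.natDegree) (hirr : Irreducible (H.map ι))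
    (x₀ : ℤ) {p : ℤ} (hp : p ≠ 0) {A B : ℤ[X]} (hAB : A ≠ 0 ∨ B ≠ 0) :
    elimLinear H x₀ p A B ≠ 0 := by
  have hchar : CharZero k := charZero_of_injective_ringHom (f := ι.comp C) (hι.comp C_injective)
  have hpk : (p : k) ≠ 0 := by exact_mod_cast hp
  let v : k := (ι X - x₀) / p
  let κ : ℤ[X] →+* k := (aeval v : ℤ[X] →ₐ[ℤ] k).toRingHom
  have hκ : κ.comp (compRingHom (C p * X + C x₀)) = ι := by
    ext <;> simp [κ, v]
    field_simp
    ring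
  have hv : Transcendental ℤ v := by
    intro halg
    have hX : Transcendental ℤ (ι X) := by
      rw [transcendental_iff_injective]
      convert hι using 1
      have : (aeval (ι X) : ℤ[X] →ₐ[ℤ] k).toRingHom = ι := by ext <;> simp
      exact congrArg (fun f : ℤ[X] →+* k => (f : ℤ[X] → k)) this
    apply hX
    have : ι X = algebraMap ℤ k p * v + algebraMap ℤ k x₀ := by
      simp [v]; field_simp; ring
    rw [this]
    exact ((isAlgebraic_algebraMap p).mul halg).add (isAlgebraic_algebraMap x₀)
  have hκi : Function.Injective κ := transcendental_iff_injective.1 hv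
  intro h0
  have h1 := congrArg κ h0
  rw [map_zero, elimLinear, eval, hom_eval₂, RingHom.comp_id, map_neg] at h1
  have hdeg : (H.map (compRingHom (C p * X + C x₀))).natDegree = H.natDegree := hH.natDegree_map _
  by_cases hB : B = 0
  · subst hB
    rw [← eval_map, map_scaleRoots _ _ _ (by rw [(hH.map _).leadingCoeff]; simp), map_zero,
      scaleRoots_zero, map_map, hκ, (hH.map ι).leadingCoeff] at h1
    have hA : κ A ≠ 0 := (map_ne_zero_iff κ hκi).2 (by simpa using hAB)
    simp at h1
    exact hA h1.1
  · have hB' : κ B ≠ 0 := (map_ne_zero_iff κ hκi).2 hB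
    have h2 : -κ A = κ B * (-κ A / κ B) := by field_simp
    rw [h2, scaleRoots_eval₂_mul, ← eval_map, map_map, hκ] at h1
    rcases mul_eq_zero.1 h1 with h | h
    · exact pow_ne_zero _ hB' h
    · have : (H.map ι).natDegree = 1 := natDegree_eq_of_degree_eq_some
        (degree_eq_one_of_irreducible_of_root hirr h)
      rw [hH.natDegree_map] at this
      omega

theorem abs_eval_le_of_coeff_le {A : ℤ[X]} {r : ℕ} (hA : A.degree < r) {N M u : ℤ}
    (hM : 1 ≤ M) (hN : ∀ i, |A.coeff i| ≤ N) (hu : |u| ≤ M) : |A.eval u| ≤ r * N * M ^ r := by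
  by_cases hA0 : A = 0
  · have : 0 ≤ N := (abs_nonneg _).trans (hN 0)
    subst hA0
    simp only [eval_zero, abs_zero]
    positivity
  rw [eval_eq_sum_range' ((natDegree_lt_iff_degree_lt hA0).2 hA)]
  refine (Finset.abs_sum_le_sum_abs _ _).trans ?_
  refine (Finset.sum_le_card_nsmul _ _ (N * M ^ r) fun i hi => ?_).trans_eq ?_
  · rw [abs_mul, abs_pow]
    refine mul_le_mul (hN i) ?_ (by positivity) ((abs_nonneg _).trans (hN 0))
    exact (pow_le_pow_left₀ (abs_nonneg _) hu _).trans
      (pow_le_pow_right₀ hM (Finset.mem_range.1 hi).le)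
  · simp [mul_assoc]

theorem dvd_evalEval_sub (H : ℤ[X][X]) {p x x' y y' : ℤ} (hx : p ∣ x - x') (hy : p ∣ y - y') :
    p ∣ H.evalEval x y - H.evalEval x' y' := by
  have a1 : p ∣ H.evalEval x y - H.evalEval x' y := by
    have := sub_dvd_eval_sub x x' (H.eval (C y))
    exact hx.trans (by simpa [evalEval] using this)
  have a2 : p ∣ H.evalEval x' y - H.evalEval x' y' := by
    refine hy.trans ?_
    rw [← map_evalRingHom_eval, ← map_evalRingHom_eval]
    exact sub_dvd_eval_sub _ _ _
  simpa using dvd_add a1 a2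

open Classical in
theorem exists_card_root_class_le {k : Type*} [Field k] {ι : ℤ[X] →+* k}
    (hι : Function.Injective ι) {H : ℤ[X][X]} (hH : H.Monic) (hd : 2 ≤ H.natDegree)
    (hirr : Irreducible (H.map ι)) {x₀ : ℤ} {U V : ℤ[X][X]} {δ : ℤ[X]}
    (hδ : U * H + V * derivative H = C δ) (hδ₀ : δ.eval x₀ ≠ 0) :
    ∃ E : ℕ, ∀ M : ℕ, ∃ p₀ : ℕ, ∀ p : ℕ, p.Prime → p₀ ≤ p → ∀ y₀ : ℤ,
      (p : ℤ) ∣ H.evalEval x₀ y₀ →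
      ((Finset.range M).filter fun u : ℕ =>
        ∃ y : ℤ, (p : ℤ) ∣ y - y₀ ∧ H.evalEval (x₀ + p * u) y = 0).card ≤ E := by
  obtain ⟨c, k, hck⟩ := exists_abs_root_le hH
  set q := k + 1 with hq
  set r := 4 * q with hr
  refine ⟨(∑ i ∈ Finset.range (H.natDegree + 1), (H.coeff i).natDegree) + 2 * H.natDegree * r,
    fun M => ?_⟩
  set S : ℕ := 1 + x₀.natAbs + M
  refine ⟨(δ.eval x₀).natAbs + r * (M + 1) ^ r * (1 + c * S ^ k) + 1, fun p hp hpp y₀ hy₀ => ?_⟩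
  have hp0 : 0 < p := hp.pos
  have hpδ : ¬ (p : ℤ) ∣ δ.eval x₀ := fun h => by
    have := Nat.le_of_dvd (Int.natAbs_pos.2 hδ₀) (Int.natCast_dvd.1 h)
    omega
  have hpd : ¬ (p : ℤ) ∣ (derivative H).evalEval x₀ y₀ := fun h => by
    apply hpδ
    have := congrArg (evalEval x₀ y₀) hδ
    simp only [evalEval_add, evalEval_mul, evalEval_C] at this
    rw [← this]
    exact dvd_add (Dvd.dvd.mul_left hy₀ _) (Dvd.dvd.mul_left h _)
  obtain ⟨a, w, haw⟩ := ((Nat.prime_iff_prime_int.1 hp).coprime_iff_not_dvd).2 hpd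
  obtain ⟨Φ, hΦ⟩ := exists_hensel_approx H p x₀ y₀ w ⟨-a, by linarith⟩ (r - 1)
  rw [Nat.sub_add_cancel (by omega)] at hΦ
  obtain ⟨A, B, hAB, hA, hB, hAc, hBc, hdvd⟩ := exists_small_linear p hp.one_lt q (by omega) Φ
  have hR := elimLinear_ne_zero hι hH hd hirr x₀ (p := p) (by exact_mod_cast hp0.ne') hAB
  have hRd := elimLinear_natDegree_le (H := H) x₀ p (natDegree_le_of_degree_le hA.le)
    (natDegree_le_of_degree_le hB.le)
  refine le_trans ?_ ((card_roots' _).trans hRd)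
  rw [← Finset.card_image_of_injective _ (Nat.cast_injective (R := ℤ))]
  refine (Finset.card_le_card ?_).trans (Multiset.toFinset_card_le _)
  intro u' hu'
  obtain ⟨u, hu, rfl⟩ := Finset.mem_image.1 hu'
  obtain ⟨huM, y, hyy, hy⟩ := Finset.mem_filter.1 hu
  have huM' := Finset.mem_range.1 huM
  rw [Multiset.mem_toFinset, mem_roots hR]
  refine elimLinear_eval hy ?_
  have h1 : (p : ℤ) ^ r ∣ A.eval (u : ℤ) + B.eval (u : ℤ) * y := by
    have e1 := hdvd u
    have e2 := hΦ (p * u) y (dvd_mul_right _ _) hyy hy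
    have e3 : A.eval (u : ℤ) + B.eval (u : ℤ) * y = (A.eval (u : ℤ) + B.eval (u : ℤ) *
        Φ.eval (p * u : ℤ)) - B.eval (u : ℤ) * (Φ.eval (p * u : ℤ) - y) := by ring
    rw [e3]
    exact dvd_sub e1 (Dvd.dvd.mul_left e2 _)
  have hMu : |(u : ℤ)| ≤ (M : ℤ) + 1 := by
    rw [abs_of_nonneg (by positivity)]; omega
  have hAu := abs_eval_le_of_coeff_le hA (by omega : (1 : ℤ) ≤ (M : ℤ) + 1) hAc hMu
  have hBu := abs_eval_le_of_coeff_le hB (by omega : (1 : ℤ) ≤ (M : ℤ) + 1) hBc hMu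
  have hy1 : |y| ≤ c * (p * S) ^ k := by
    refine (hck _ _ hy).trans (mul_le_mul_of_nonneg_left ?_ (by positivity))
    refine pow_le_pow_left₀ (by positivity) ?_ _
    have hp1 : (1 : ℤ) ≤ p := by exact_mod_cast hp0
    have h2 : |x₀ + p * u| ≤ |x₀| + p * u := by
      refine (abs_add_le _ _).trans ?_
      rw [abs_of_nonneg (by positivity : (0 : ℤ) ≤ p * u)]
    have h3 : (u : ℤ) ≤ M := by exact_mod_cast huM'.le
    have h4 := abs_nonneg x₀
    simp only [S]
    push_cast
    nlinarith
  refine Int.eq_zero_of_abs_lt_dvd h1 ?_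
  set N : ℤ := r * (p : ℤ) ^ (3 * q) * ((M : ℤ) + 1) ^ r with hN
  have hN0 : 0 ≤ N := by positivity
  calc |A.eval (u : ℤ) + B.eval (u : ℤ) * y|
      ≤ |A.eval (u : ℤ)| + |B.eval (u : ℤ)| * |y| := by
        rw [← abs_mul]; exact abs_add_le _ _
    _ ≤ N + N * (c * (p * S) ^ k) :=
        add_le_add hAu (mul_le_mul hBu hy1 (abs_nonneg _) hN0)
    _ ≤ N * p ^ k + N * (c * (p * S) ^ k) := by
        have : (1 : ℤ) ≤ (p : ℤ) ^ k := one_le_pow₀ (by exact_mod_cast hp0)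
        nlinarith
    _ = (r * ((M : ℤ) + 1) ^ r * (1 + c * S ^ k)) * (p : ℤ) ^ (3 * q + k) := by
        rw [hN]; ring
    _ < p * (p : ℤ) ^ (3 * q + k) := by
        refine mul_lt_mul_of_pos_right ?_ (by positivity)
        have : r * (M + 1) ^ r * (1 + c * S ^ k) < p := by omega
        exact_mod_cast this
    _ = (p : ℤ) ^ r := by
        rw [← pow_succ']; congr 1; omega

open Classical in
theorem exists_card_root_le {k : Type*} [Field k] {ι : ℤ[X] →+* k}
    (hι : Function.Injective ι) {H : ℤ[X][X]} (hH : H.Monic) (hd : 2 ≤ H.natDegree)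
    (hirr : Irreducible (H.map ι)) {x₀ : ℤ} {U V : ℤ[X][X]} {δ : ℤ[X]}
    (hδ : U * H + V * derivative H = C δ) (hδ₀ : δ.eval x₀ ≠ 0) :
    ∃ E : ℕ, ∀ M : ℕ, ∃ p₀ : ℕ, ∀ p : ℕ, p.Prime → p₀ ≤ p →
      ((Finset.range M).filter fun u : ℕ => ∃ y : ℤ, H.evalEval (x₀ + p * u) y = 0).card ≤ E := by
  obtain ⟨E, hE⟩ := exists_card_root_class_le hι hH hd hirr hδ hδ₀
  refine ⟨H.natDegree * E, fun M => ?_⟩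
  obtain ⟨p₀, hp₀⟩ := hE M
  refine ⟨p₀, fun p hp hpp => ?_⟩
  have : Fact p.Prime := ⟨hp⟩
  set P := (H.map (evalRingHom x₀)).map (Int.castRingHom (ZMod p)) with hPdef
  have hP : P.Monic := (hH.map _).map _
  have hPe : ∀ y : ℤ, P.eval (y : ZMod p) = (H.evalEval x₀ y : ℤ) := fun y => by
    rw [hPdef, ← map_evalRingHom_eval, eval_intCast_map]
    simp
  let W : ZMod p → Finset ℕ := fun c => (Finset.range M).filter fun u : ℕ =>
    ∃ y : ℤ, (p : ℤ) ∣ y - c.val ∧ H.evalEval (x₀ + p * u) y = 0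
  have hTsub : ((Finset.range M).filter fun u : ℕ => ∃ y : ℤ, H.evalEval (x₀ + p * u) y = 0) ⊆
      P.roots.toFinset.biUnion W := by
    intro u hu
    obtain ⟨huM, y, hy⟩ := Finset.mem_filter.1 hu
    refine Finset.mem_biUnion.2 ⟨(y : ZMod p), ?_, Finset.mem_filter.2 ⟨huM, y, ?_, hy⟩⟩
    · rw [Multiset.mem_toFinset, mem_roots hP.ne_zero, IsRoot, hPe,
        ZMod.intCast_zmod_eq_zero_iff_dvd]
      have := dvd_evalEval_sub H (p := p) (x := x₀ + p * u) (x' := x₀) (y := y) (y' := y)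
        ⟨u, by ring⟩ (by simp)
      rw [hy, zero_sub] at this
      exact (dvd_neg).1 this
    · rw [← ZMod.intCast_eq_intCast_iff_dvd_sub]
      simp
  refine (Finset.card_le_card hTsub).trans ((Finset.card_biUnion_le_card_mul _ _ E ?_).trans ?_)
  · intro c hc
    rw [Multiset.mem_toFinset, mem_roots hP.ne_zero, IsRoot] at hc
    refine hp₀ p hp hpp c.val ?_
    rw [← ZMod.intCast_zmod_eq_zero_iff_dvd, ← hPe]
    simpa using hc
  · refine Nat.mul_le_mul_right _ ((Multiset.toFinset_card_le _).trans ((card_roots' _).trans ?_))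
    exact natDegree_map_le.trans natDegree_map_le

theorem exists_resultant_derivative {k : Type*} [Field k] {ι : ℤ[X] →+* k}
    (hι : Function.Injective ι) {H : ℤ[X][X]} (hd : 2 ≤ H.natDegree)
    (hirr : Irreducible (H.map ι)) :
    ∃ (U V : ℤ[X][X]) (δ : ℤ[X]), δ ≠ 0 ∧ U * H + V * derivative H = C δ := by
  have hchar : CharZero k := charZero_of_injective_ringHom (f := ι.comp C) (hι.comp C_injective)
  have hsep : IsCoprime (H.map ι) ((derivative H).map ι) := by
    rw [← derivative_map]; exact hirr.separable
  obtain ⟨U, V, -, -, h⟩ := exists_mul_add_mul_eq_C_resultant H (derivative H) le_rfl le_rfl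
    (Or.inl (by omega))
  refine ⟨U, V, resultant H (derivative H), fun h0 => ?_, ?_⟩
  · have := resultant_ne_zero _ _ hsep
    rw [natDegree_map_eq_of_injective hι, natDegree_map_eq_of_injective hι, resultant_map_map, h0,
      map_zero] at this
    exact this rfl
  · rw [← h]; ring

/-- A form of Hilbert's irreducibility theorem. -/
theorem exists_int_specialization_no_root {k : Type*} [Field k] {ι : ℤ[X] →+* k}
    (hι : Function.Injective ι) {I : Type*} [Finite I] (H : I → ℤ[X][X])
    (hH : ∀ i, (H i).Monic) (hd : ∀ i, 2 ≤ (H i).natDegree) (hirr : ∀ i, Irreducible ((H i).map ι))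
    {s : ℤ[X]} (hs : s ≠ 0) :
    ∃ x : ℤ, s.eval x ≠ 0 ∧ ∀ i, ∀ y : ℤ, (H i).evalEval x y ≠ 0 := by
  classical
  have := Fintype.ofFinite I
  choose U V δ hδ₀ hδ using fun i => exists_resultant_derivative hι (hd i) (hirr i)
  obtain ⟨x₀, hx₀⟩ : ∃ x₀ : ℤ, (∏ i, δ i).eval x₀ ≠ 0 := by
    by_contra! h
    exact Finset.prod_ne_zero_iff.2 (fun i _ => hδ₀ i) (zero_of_eval_zero _ h)
  rw [eval_prod, Finset.prod_ne_zero_iff] at hx₀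
  choose E hE using fun i =>
    exists_card_root_le hι (hH i) (hd i) (hirr i) (hδ i) (hx₀ i (Finset.mem_univ i))
  set M := (∑ i, E i) + s.natDegree + 1
  choose p₀ hp₀ using fun i => hE i M
  obtain ⟨p, hpp, hp⟩ := Nat.exists_infinite_primes (∑ i, p₀ i)
  set W : I → Finset ℕ := fun i =>
    (Finset.range M).filter fun u : ℕ => ∃ y : ℤ, (H i).evalEval (x₀ + p * u) y = 0
  set Z : Finset ℕ := (Finset.range M).filter fun u : ℕ => s.eval (x₀ + p * u) = 0
  have hZ : Z.card ≤ s.natDegree := by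
    refine le_trans ?_ (card_roots' s)
    have hinj : Function.Injective fun u : ℕ => x₀ + (p : ℤ) * u := fun u v h => by
      simpa [hp.ne_zero] using h
    rw [← Finset.card_image_of_injective _ hinj]
    refine (Finset.card_le_card ?_).trans (Multiset.toFinset_card_le _)
    intro z hz
    obtain ⟨u, hu, rfl⟩ := Finset.mem_image.1 hz
    rw [Multiset.mem_toFinset, mem_roots hs]
    exact (Finset.mem_filter.1 hu).2
  have hcard : (Finset.univ.biUnion W ∪ Z).card < (Finset.range M).card := by
    rw [Finset.card_range]
    refine Nat.lt_succ_of_le ((Finset.card_union_le _ _).trans (add_le_add ?_ hZ))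
    refine Finset.card_biUnion_le.trans (Finset.sum_le_sum fun i _ => hp₀ i p hp ?_)
    exact (Finset.single_le_sum (f := p₀) (fun _ _ => Nat.zero_le _) (Finset.mem_univ i)).trans hpp
  obtain ⟨u, huM, hu⟩ := Finset.exists_mem_notMem_of_card_lt_card hcard
  rw [Finset.mem_union, not_or] at hu
  refine ⟨x₀ + p * u, fun h => hu.2 (Finset.mem_filter.2 ⟨huM, h⟩), fun i y h => hu.1 ?_⟩
  exact Finset.mem_biUnion.2 ⟨i, Finset.mem_univ i, Finset.mem_filter.2 ⟨huM, y, h⟩⟩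

theorem exists_intPolynomial_multiple (f : ℚ[X]) :
    ∃ (d : ℤ) (g : ℤ[X]), d ≠ 0 ∧ g.map (Int.castRingHom ℚ) = C (d : ℚ) * f := by
  obtain ⟨b, hb, h⟩ := IsLocalization.integerNormalization_spec (nonZeroDivisors ℤ) f
  refine ⟨b, _, nonZeroDivisors.ne_zero hb, h.trans ?_⟩
  rw [← smul_eq_C_mul, Int.cast_smul_eq_zsmul]

theorem exists_integral_multiple_minpoly {K E : Type*} [Field K] [Field E] [Algebra ℚ[X] K]
    [IsFractionRing ℚ[X] K] [Algebra K E] [Algebra.IsAlgebraic K E] {c : E}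
    (hc : c ∉ (algebraMap K E).range) {ι : ℤ[X] →+* K}
    (hι : ι = (algebraMap ℚ[X] K).comp (mapRingHom (Int.castRingHom ℚ))) :
    ∃ a : ℤ[X], a ≠ 0 ∧ ∃ H : ℤ[X][X], H.Monic ∧ 2 ≤ H.natDegree ∧ Irreducible (H.map ι) ∧
      H.eval₂ ((algebraMap K E).comp ι) (algebraMap K E (ι a) * c) = 0 := by
  have hιi : Function.Injective ι := by
    rw [hι]
    exact (IsFractionRing.injective ℚ[X] K).comp
      (map_injective _ Int.cast_injective)
  let : Algebra ℤ[X] K := ι.toAlgebra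
  let : Algebra ℤ[X] E := ((algebraMap K E).comp ι).toAlgebra
  have : IsScalarTower ℤ[X] K E := IsScalarTower.of_algebraMap_eq' rfl
  have : FaithfulSMul ℤ[X] K := (faithfulSMul_iff_algebraMap_injective _ _).2 hιi
  have hfr : IsFractionRing ℤ[X] K := by
    refine IsFractionRing.of_field _ _ fun z => ?_
    obtain ⟨u, v, hv, rfl⟩ := IsFractionRing.div_surjective ℚ[X] z
    obtain ⟨d, u', hd, hu⟩ := exists_intPolynomial_multiple u
    obtain ⟨e, v', he, hv'⟩ := exists_intPolynomial_multiple v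
    refine ⟨C e * u', C d * v', ?_⟩
    have key : ∀ (d : ℤ) (f : ℚ[X]) (g : ℤ[X]), g.map (Int.castRingHom ℚ) = C (d : ℚ) * f →
        ι g = d * algebraMap ℚ[X] K f := fun d f g h => by
      rw [hι, RingHom.comp_apply, coe_mapRingHom, h, map_mul]
      simp
    have hde : ∀ d : ℤ, ι (C d) = d := fun d => by simp
    have hchar : CharZero K := charZero_of_injective_ringHom (f := ι.comp C) (hιi.comp C_injective)
    have hd' : (d : K) ≠ 0 := by exact_mod_cast hd
    have he' : (e : K) ≠ 0 := by exact_mod_cast he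
    have hv0 : algebraMap ℚ[X] K v ≠ 0 :=
      (map_ne_zero_iff _ (IsFractionRing.injective ℚ[X] K)).2 (nonZeroDivisors.ne_zero hv)
    change _ = ι (C e * u') / ι (C d * v')
    rw [map_mul, map_mul, hde, hde, key d u u' hu, key e v v' hv']
    field_simp
  have : Algebra.IsAlgebraic ℤ[X] E :=
    (IsFractionRing.comap_isAlgebraic_iff (K := K)).2 inferInstance
  obtain ⟨a, ha, hcint⟩ := IsAlgebraic.exists_integral_multiple
    (Algebra.IsAlgebraic.isAlgebraic (R := ℤ[X]) c)
  refine ⟨a, ha, minpoly ℤ[X] (a • c), minpoly.monic hcint, ?_, ?_, ?_⟩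
  · rw [minpoly.two_le_natDegree_iff hcint]
    rintro ⟨z, hz⟩
    apply hc
    have ha' : algebraMap K E (ι a) ≠ 0 := by
      rwa [_root_.map_ne_zero, map_ne_zero_iff _ hιi]
    have hz' : algebraMap K E (ι z) = algebraMap K E (ι a) * c :=
      hz.trans (Algebra.smul_def a c)
    exact ⟨ι z / ι a, by rw [map_div₀, hz', mul_div_cancel_left₀ _ ha']⟩
  · have := minpoly.isIntegrallyClosed_eq_field_fractions' K hcint
    change Irreducible ((minpoly ℤ[X] (a • c)).map (algebraMap ℤ[X] K))
    rw [← this]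
    exact minpoly.irreducible (hcint.tower_top)
  · have := minpoly.aeval ℤ[X] (a • c)
    rwa [Algebra.smul_def] at this

theorem exists_mem_fixedField_notMem_range {K E : Type*} [Field K] [Field E] [Algebra K E]
    [FiniteDimensional K E] [IsGalois K E] {H : Subgroup Gal(E/K)} (hH : H ≠ ⊤) :
    ∃ c : E, c ∉ (algebraMap K E).range ∧ ∀ σ ∈ H, σ c = c := by
  by_contra! h
  apply hH
  rw [← IntermediateField.fixingSubgroup_fixedField H, ← IntermediateField.fixingSubgroup_bot]
  congr 1
  rw [eq_bot_iff]
  intro c hc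
  by_contra hc'
  obtain ⟨σ, hσ, hne⟩ := h c (fun ⟨z, hz⟩ => hc' (IntermediateField.mem_bot.2 ⟨z, hz⟩))
  exact hne (hc ⟨σ, hσ⟩)

open scoped Pointwise in
attribute [local instance] Ideal.Quotient.field in
theorem mk_mem_range_of_stabilizer_le {B G : Type*} [CommRing B] [Group G] [Finite G]
    [Algebra ℚ[X] B] [MulSemiringAction G B] [SMulCommClass G ℚ[X] B]
    [Algebra.IsInvariant ℚ[X] B G] (P : Ideal B)
    [P.IsMaximal] {x : ℚ} (hx : algebraMap ℚ[X] B (X - C x) ∈ P) {b : B}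
    (hb : ∀ σ ∈ MulAction.stabilizer G P, σ • b = b) :
    ∃ t : ℚ, Ideal.Quotient.mk P b = Ideal.Quotient.mk P (algebraMap ℚ[X] B (C t)) := by
  let p : Ideal ℚ[X] := Ideal.span {X - C x}
  have hp : p.IsMaximal := PrincipalIdealRing.isMaximal_of_irreducible (irreducible_X_sub_C x)
  have hle : p ≤ P.comap (algebraMap ℚ[X] B) := by
    rw [Ideal.span_singleton_le_iff_mem]
    exact hx
  have hlo : P.LiesOver p :=
    ⟨hp.eq_of_le (Ideal.comap_ne_top _ (Ideal.IsPrime.ne_top inferInstance)) hle⟩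
  have hn := Ideal.Quotient.normal G p P
  have : CharZero (ℚ[X] ⧸ p) := by
    exact charZero_of_injective_algebraMap (algebraMap ℚ (ℚ[X] ⧸ p)).injective
  have hfin := Ideal.Quotient.finite_of_isInvariant G p P
  have hg : IsGalois (ℚ[X] ⧸ p) (B ⧸ P) := { }
  obtain ⟨z, hz⟩ := IsGalois.mem_range_algebraMap_iff_fixed (F := ℚ[X] ⧸ p)
    (Ideal.Quotient.mk P b) |>.2
    fun τ => by
      obtain ⟨σ, rfl⟩ := Ideal.Quotient.stabilizerHom_surjective G p P τ
      have := hb σ σ.2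
      conv_rhs => rw [← this]
      rfl
  obtain ⟨f, rfl⟩ := Ideal.Quotient.mk_surjective z
  refine ⟨f.eval x, hz.symm.trans ?_⟩
  rw [Ideal.Quotient.algebraMap_mk_of_liesOver, Ideal.Quotient.eq, ← map_sub]
  obtain ⟨g, hg⟩ := X_sub_C_dvd_sub_C_eval (a := x) (p := f)
  rw [hg, map_mul]
  exact Ideal.mul_mem_right _ _ hx

open scoped Pointwise in
theorem exists_int_stabilizer_eq_top {K E B : Type*} [Field K] [Field E] [CommRing B]
    [Algebra ℚ[X] K] [IsFractionRing ℚ[X] K] [Algebra K E] [FiniteDimensional K E] [IsGalois K E]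
    [Algebra ℚ[X] E] [IsScalarTower ℚ[X] K E] [Algebra ℚ[X] B] [Algebra B E]
    [IsScalarTower ℚ[X] B E] [IsIntegralClosure B ℚ[X] E] [IsFractionRing B E]
    {s : ℤ[X]} (hs : s ≠ 0) :
    ∃ x : ℤ, s.eval x ≠ 0 ∧ ∀ P : Ideal B, P.IsMaximal →
      algebraMap ℚ[X] B (X - C (x : ℚ)) ∈ P → ∀ (σ : Gal(E/K)) (b : B), b ∈ P →
        galRestrict ℚ[X] K E B σ b ∈ P := by
  let ι : ℤ[X] →+* K := (algebraMap ℚ[X] K).comp (mapRingHom (Int.castRingHom ℚ))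
  have hιi : Function.Injective ι :=
    (IsFractionRing.injective ℚ[X] K).comp (map_injective _ Int.cast_injective)
  choose c hc hcH using fun H : {H : Subgroup Gal(E/K) // H ≠ ⊤} =>
    exists_mem_fixedField_notMem_range H.2
  choose a ha F hF hd hirr hroot using fun H => exists_integral_multiple_minpoly (hc H) (ι := ι) rfl
  obtain ⟨x, hsx, hx⟩ := exists_int_specialization_no_root hιi F hF hd hirr hs
  refine ⟨x, hsx, fun P hP hxP => ?_⟩
  let := IsIntegralClosure.MulSemiringAction ℚ[X] K E B
  have := Algebra.isInvariant_of_isGalois ℚ[X] K E B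
  have : SMulCommClass Gal(E/K) ℚ[X] B :=
    ⟨fun σ f b => map_smul (galRestrict ℚ[X] K E B σ) f b⟩
  suffices hst : MulAction.stabilizer Gal(E/K) P = ⊤ by
    intro σ b hb
    have h1 : σ ∈ MulAction.stabilizer Gal(E/K) P := hst ▸ Subgroup.mem_top σ
    have h2 := Ideal.smul_mem_pointwise_smul σ b P hb
    rw [MulAction.mem_stabilizer_iff.1 h1] at h2
    exact h2
  by_contra hst
  let H : {H : Subgroup Gal(E/K) // H ≠ ⊤} := ⟨_, hst⟩
  let φ : ℤ[X] →+* B := (algebraMap ℚ[X] B).comp (mapRingHom (Int.castRingHom ℚ))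
  have hφ : (algebraMap B E).comp φ = (algebraMap K E).comp ι := by
    simp only [φ, ι, ← RingHom.comp_assoc, ← IsScalarTower.algebraMap_eq]
  have hcint : IsIntegral ℚ[X] (algebraMap K E (ι (a H)) * c H) := by
    refine ⟨(F H).map (mapRingHom (Int.castRingHom ℚ)), (hF H).map _, ?_⟩
    rw [eval₂_map, ← hroot H]
    congr 1
    rw [← hφ, ← RingHom.comp_assoc, ← IsScalarTower.algebraMap_eq]
  obtain ⟨b, hb⟩ := (IsIntegralClosure.isIntegral_iff (A := B)).1 hcint
  have hbinj : Function.Injective (algebraMap B E) := IsFractionRing.injective B E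
  have hbr : (F H).eval₂ φ b = 0 := by
    apply hbinj
    rw [hom_eval₂, hφ, hb, hroot, map_zero]
  obtain ⟨t, ht⟩ := mk_mem_range_of_stabilizer_le (G := Gal(E/K)) P hxP (b := b) fun σ hσ => by
    apply hbinj
    have h1 : algebraMap B E (σ • b) = σ (algebraMap B E b) := algebraMap_galRestrict_apply _ _ _
    rw [h1, hb, map_mul, AlgEquiv.commutes, hcH H σ hσ]
  let ψ : ℚ →+* B ⧸ P := (Ideal.Quotient.mk P).comp ((algebraMap ℚ[X] B).comp C)
  have hψ : (Ideal.Quotient.mk P).comp φ = ψ.comp ((Int.castRingHom ℚ).comp (evalRingHom x)) := by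
    ext
    · simp
    · have h1 := (Ideal.Quotient.eq (I := P)).2 (by rwa [← map_sub] : algebraMap ℚ[X] B X -
        algebraMap ℚ[X] B (C (x : ℚ)) ∈ P)
      simpa [ψ, φ] using h1
  have h0 : ((F H).map (evalRingHom x)).eval₂ (Int.castRingHom ℚ) t = 0 := by
    apply ψ.injective
    have h1 : ψ t = Ideal.Quotient.mk P b := ht.symm
    rw [hom_eval₂, h1, eval₂_map, RingHom.comp_assoc, ← hψ, ← hom_eval₂, hbr, map_zero, map_zero]
  obtain ⟨y, rfl⟩ := IsIntegrallyClosed.isIntegral_iff.1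
    (show IsIntegral ℤ t from ⟨_, (hF H).map _, h0⟩)
  refine hx H y ?_
  rw [← map_evalRingHom_eval]
  have h2 : ((F H).map (evalRingHom x)).eval₂ (Int.castRingHom ℚ) (Int.castRingHom ℚ y) = 0 := h0
  rw [eval₂_at_apply] at h2
  exact (map_eq_zero_iff _ Int.cast_injective).1 h2

instance : Algebra.IsAlgebraic ℚ Qbar := by
  have h : @Algebra.IsAlgebraic ℚ Qbar _ _ (AlgebraicClosure.instAlgebra ℚ) :=
    AlgebraicClosure.isAlgebraic ℚ
  rwa [Subsingleton.elim (AlgebraicClosure.instAlgebra ℚ) DivisionRing.toRatAlgebra] at h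

instance : Normal ℚ Qbar where
  splits' _ := IsAlgClosed.splits _

attribute [local instance] Ideal.Quotient.field in
theorem exists_ringHom_Qbar {B : Type*} [CommRing B] [IsDomain B] [Algebra ℚ[X] B]
    [Algebra.IsIntegral ℚ[X] B] [FaithfulSMul ℚ[X] B] (x : ℚ) :
    ∃ ψ : B →+* Qbar, (RingHom.ker ψ).IsMaximal ∧ ψ (algebraMap ℚ[X] B X) = x := by
  let p : Ideal ℚ[X] := Ideal.span {X - C x}
  have hp : p.IsMaximal := PrincipalIdealRing.isMaximal_of_irreducible (irreducible_X_sub_C x)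
  obtain ⟨P, hP, hPp⟩ := Ideal.exists_maximal_ideal_liesOver_of_isIntegral (S := B) p
  have hX : algebraMap ℚ[X] B (X - C x) ∈ P := by
    change X - C x ∈ Ideal.under ℚ[X] P
    rw [← hPp.over]
    exact Ideal.mem_span_singleton_self _
  let ρ : ℚ →+* B ⧸ P := (Ideal.Quotient.mk P).comp ((algebraMap ℚ[X] B).comp C)
  have hchar : CharZero (B ⧸ P) := charZero_of_injective_ringHom ρ.injective
  have hρ : algebraMap ℚ (B ⧸ P) = ρ := Subsingleton.elim _ _
  have hmkX : Ideal.Quotient.mk P (algebraMap ℚ[X] B X) = ρ x := by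
    rw [map_sub] at hX
    exact Ideal.Quotient.eq.2 hX
  have hcomp : (Ideal.Quotient.mk P).comp (algebraMap ℚ[X] B) = ρ.comp (evalRingHom x) := by
    refine Polynomial.ringHom_ext (fun a => ?_) ?_
    · simp [ρ]
    · simpa using hmkX
  have halg : Algebra.IsAlgebraic ℚ (B ⧸ P) := by
    refine ⟨fun z => ?_⟩
    obtain ⟨b, rfl⟩ := Ideal.Quotient.mk_surjective z
    obtain ⟨F, hF, hFb⟩ := Algebra.IsIntegral.isIntegral (R := ℚ[X]) b
    refine IsIntegral.isAlgebraic ⟨F.map (evalRingHom x), hF.map _, ?_⟩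
    rw [hρ, eval₂_map, ← hcomp, ← hom_eval₂, hFb, map_zero]
  let θ : B ⧸ P →ₐ[ℚ] Qbar := IsAlgClosed.lift
  refine ⟨θ.toRingHom.comp (Ideal.Quotient.mk P), ?_, ?_⟩
  · rw [RingHom.ker_comp_of_injective _ θ.injective, Ideal.mk_ker]
    exact hP
  · rw [RingHom.comp_apply, hmkX, ← hρ]
    exact θ.commutes x

theorem exists_ringHom_Qbar_extend {B : Type*} [CommRing B] [IsDomain B] [Algebra ℚ[X] B]
    [Algebra.IsIntegral ℚ[X] B] [FaithfulSMul ℚ[X] B] (x : ℚ) (L : IntermediateField ℚ Qbar)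
    (j : L →+* B) :
    ∃ ψ : B →+* Qbar, (RingHom.ker ψ).IsMaximal ∧ ψ (algebraMap ℚ[X] B X) = x ∧
      ∀ l : L, ψ (j l) = l := by
  obtain ⟨ψ, hψ, hX⟩ := exists_ringHom_Qbar (B := B) x
  let φ : L →ₐ[ℚ] Qbar := (ψ.comp j).toRatAlgHom
  let τ : Qbar ≃ₐ[ℚ] Qbar := AlgEquiv.ofBijective (φ.liftNormal Qbar)
    (Algebra.IsAlgebraic.algHom_bijective _)
  have hτ : ∀ l : L, τ l = ψ (j l) := φ.liftNormal_commutes Qbar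
  refine ⟨(τ.symm : Qbar →+* Qbar).comp ψ, ?_, ?_, fun l => ?_⟩
  · rwa [RingHom.ker_comp_of_injective _ τ.symm.injective]
  · rw [RingHom.comp_apply, hX]
    exact map_ratCast _ _
  · rw [RingHom.comp_apply, ← hτ]
    exact τ.symm_apply_apply _

/-- The homogenization of `g` in its second variable, with respect to a third variable. -/
def homogenizeSnd {R : Type*} [CommRing R] (g : MvPolynomial (Fin 2) R) : MvPolynomial (Fin 3) R :=
  ∑ m ∈ g.support, MvPolynomial.C (g.coeff m) * MvPolynomial.X 0 ^ m 0 * MvPolynomial.X 1 ^ m 1 *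
    MvPolynomial.X 2 ^ (g.degreeOf 1 - m 1)

theorem eval₂_homogenizeSnd {R A : Type*} [CommRing R] [CommRing A] (g : MvPolynomial (Fin 2) R)
    (φ : R →+* A) (x y s : A) :
    (homogenizeSnd g).eval₂ φ ![x, s * y, s] = s ^ g.degreeOf 1 * g.eval₂ φ ![x, y] := by
  rw [homogenizeSnd, MvPolynomial.eval₂_sum, MvPolynomial.eval₂_eq', Finset.mul_sum]
  refine Finset.sum_congr rfl fun m hm => ?_
  obtain ⟨k, hk⟩ := Nat.exists_eq_add_of_le (MvPolynomial.monomial_le_degreeOf 1 hm)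
  simp [MvPolynomial.eval₂_mul, Fin.prod_univ_two, hk]
  ring

theorem exists_specialization {K E : Type*} [Field K] [Field E]
    [Algebra ℚ[X] K] [IsFractionRing ℚ[X] K] [Algebra K E] [FiniteDimensional K E] [IsGalois K E]
    [Algebra ℚ[X] E] [IsScalarTower ℚ[X] K E] (L : IntermediateField ℚ Qbar) (j : L →+* E) (y : E)
    (N : IntermediateField K E) (hy : y ∈ N) (T : Set Qbar)
    (hT : ∀ t ∈ T, ∃ h : t ∈ L, j ⟨t, h⟩ ∈ N) :
    ∃ (a b : Qbar),
      (∀ g : MvPolynomial (Fin 2) L, g.eval₂ j ![algebraMap ℚ[X] E X, y] = 0 →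
        g.eval₂ (algebraMap L Qbar) ![a, b] = 0) ∧
      ∀ β : L, j β ∉ N → (β : Qbar) ∉ IntermediateField.adjoin ℚ (T ∪ {a, b}) := by
  let B := integralClosure ℚ[X] E
  have : IsFractionRing B E := IsIntegralClosure.isFractionRing_of_finite_extension ℚ[X] K E B
  have : FaithfulSMul ℚ[X] E := by
    rw [faithfulSMul_iff_algebraMap_injective, IsScalarTower.algebraMap_eq ℚ[X] K E]
    exact (algebraMap K E).injective.comp (IsFractionRing.injective ℚ[X] K)
  have : Algebra.IsAlgebraic ℚ[X] E :=
    (IsFractionRing.comap_isAlgebraic_iff (K := K)).2 inferInstance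
  obtain ⟨s, hs, hsy⟩ := IsAlgebraic.exists_integral_multiple
    (Algebra.IsAlgebraic.isAlgebraic (R := ℚ[X]) y)
  obtain ⟨d, s', hd, hs'⟩ := exists_intPolynomial_multiple s
  have hs'0 : s' ≠ 0 := by
    rintro rfl
    simp [hd, hs] at hs'
  obtain ⟨x, hsx, hx⟩ := exists_int_stabilizer_eq_top (K := K) (E := E) (B := B) hs'0
  have hsx' : s.eval (x : ℚ) ≠ 0 := by
    intro h
    apply hsx
    have h1 := congrArg (eval (x : ℚ)) hs'
    rw [eval_mul, h, mul_zero, eval_intCast_map] at h1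
    exact (map_eq_zero_iff _ Int.cast_injective).1 h1
  have hjint : ∀ l : L, IsIntegral ℚ[X] (j l) := fun l => by
    have hl : IsIntegral ℚ l := (isIntegral_algebraMap_iff (algebraMap L Qbar).injective).1
      (Algebra.IsIntegral.isIntegral (l : Qbar))
    refine ⟨(minpoly ℚ l).map C, (minpoly.monic hl).map _, ?_⟩
    have h1 : (algebraMap ℚ[X] E).comp C = j.comp (algebraMap ℚ L) := Subsingleton.elim _ _
    rw [eval₂_map, h1, ← hom_eval₂, ← aeval_def, minpoly.aeval, map_zero]
  let jB : L →+* B := j.codRestrict B hjint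
  have hjB : ∀ l, algebraMap B E (jB l) = j l := fun l => rfl
  obtain ⟨ψ, hψ, hψX, hψj⟩ := exists_ringHom_Qbar_extend (B := B) x L jB
  have hbinj : Function.Injective (algebraMap B E) := IsFractionRing.injective B E
  have hψp : ∀ f : ℚ[X], ψ (algebraMap ℚ[X] B f) = algebraMap ℚ Qbar (f.eval (x : ℚ)) := by
    have : ψ.comp (algebraMap ℚ[X] B) = (algebraMap ℚ Qbar).comp (evalRingHom (x : ℚ)) := by
      refine Polynomial.ringHom_ext (fun a => ?_) ?_
      · exact RingHom.congr_fun (Subsingleton.elim (ψ.comp ((algebraMap ℚ[X] B).comp C))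
          (((algebraMap ℚ Qbar).comp (evalRingHom (x : ℚ))).comp C)) a
      · simpa using hψX
    exact fun f => congrArg (fun φ => φ f) this
  have hσ := hx (RingHom.ker ψ) hψ (by
    rw [RingHom.mem_ker, hψp]; simp)
  let y' : B := ⟨s • y, hsy⟩
  have hs0 : algebraMap ℚ Qbar (s.eval (x : ℚ)) ≠ 0 :=
    (map_ne_zero_iff _ (algebraMap ℚ Qbar).injective).2 hsx'
  let b : Qbar := ψ y' / algebraMap ℚ Qbar (s.eval (x : ℚ))
  have hb : ψ y' = algebraMap ℚ Qbar (s.eval (x : ℚ)) * b := by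
    simp only [b]; field_simp
  refine ⟨algebraMap ℚ Qbar x, b, fun g hg => ?_, fun β hβ hmem => ?_⟩
  · have hw : (homogenizeSnd g).eval₂ jB ![algebraMap ℚ[X] B X, y', algebraMap ℚ[X] B s] = 0 := by
      apply hbinj
      have h1 : (algebraMap B E) ∘ ![algebraMap ℚ[X] B X, y', algebraMap ℚ[X] B s] =
          ![algebraMap ℚ[X] E X, algebraMap ℚ[X] E s * y, algebraMap ℚ[X] E s] := by
        ext i; fin_cases i
        · rfl
        · exact Algebra.smul_def s y
        · rfl
      rw [MvPolynomial.eval₂_comp_left, h1, map_zero]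
      exact (eval₂_homogenizeSnd g j _ _ _).trans (by rw [hg, mul_zero])
    have h2 := congrArg ψ hw
    have h1 : ψ ∘ ![algebraMap ℚ[X] B X, y', algebraMap ℚ[X] B s] =
        ![algebraMap ℚ Qbar x, algebraMap ℚ Qbar (s.eval (x : ℚ)) * b,
          algebraMap ℚ Qbar (s.eval (x : ℚ))] := by
      ext i; fin_cases i
      · simpa using hψX
      · exact hb
      · exact hψp s
    have h3 : ψ.comp jB = algebraMap L Qbar := RingHom.ext hψj
    rw [MvPolynomial.eval₂_comp_left, h1, h3, eval₂_homogenizeSnd, map_zero] at h2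
    exact (mul_eq_zero.1 h2).resolve_left (pow_ne_zero _ hs0)
  · obtain ⟨σ, hσN, hσβ⟩ : ∃ σ ∈ N.fixingSubgroup, σ (j β) ≠ j β := by
      by_contra! h
      apply hβ
      rw [← IsGalois.fixedField_fixingSubgroup N]
      exact fun σ => h σ σ.2
    let R : Subalgebra ℚ Qbar :=
      { (N.toSubring.comap (algebraMap B E)).map ψ with
        algebraMap_mem' := fun q => by
          refine ⟨algebraMap ℚ[X] B (C q), ?_, ?_⟩
          · have : algebraMap B E (algebraMap ℚ[X] B (C q)) =
                algebraMap K E (algebraMap ℚ[X] K (C q)) := by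
              rw [← IsScalarTower.algebraMap_apply, ← IsScalarTower.algebraMap_apply]
            change algebraMap B E (algebraMap ℚ[X] B (C q)) ∈ N
            rw [this]
            exact N.algebraMap_mem _
          · rw [hψp, eval_C] }
    have hmemR : ∀ z : B, algebraMap B E z ∈ N → ψ z ∈ R := fun z hz => ⟨z, hz, rfl⟩
    have hpN : ∀ f : ℚ[X], algebraMap ℚ[X] E f ∈ N := fun f => by
      rw [IsScalarTower.algebraMap_apply ℚ[X] K E]
      exact N.algebraMap_mem _
    have hle : Algebra.adjoin ℚ (T ∪ {algebraMap ℚ Qbar x, b}) ≤ R := by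
      refine Algebra.adjoin_le ?_
      rintro t (ht | rfl | rfl)
      · obtain ⟨h, ht'⟩ := hT t ht
        have := hmemR (jB ⟨t, h⟩) ht'
        rwa [hψj] at this
      · exact R.algebraMap_mem _
      · have h1 : b = algebraMap ℚ Qbar (s.eval (x : ℚ))⁻¹ * ψ y' := by
          rw [hb, map_inv₀]; field_simp
        rw [h1]
        refine R.mul_mem (R.algebraMap_mem _) (hmemR y' ?_)
        change s • y ∈ N
        rw [Algebra.smul_def]
        exact N.mul_mem (hpN s) hy
    rw [← IntermediateField.mem_toSubalgebra, IntermediateField.adjoin_toSubalgebra_of_isAlgebraic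
      fun z _ => Algebra.IsAlgebraic.isAlgebraic z] at hmem
    obtain ⟨z, hzN, hz⟩ := hle hmem
    have hgal : ∀ w : B, algebraMap B E (galRestrict ℚ[X] K E B σ w) = σ (algebraMap B E w) :=
      fun w => algebraMap_galRestrict_apply _ _ _
    have hσz : galRestrict ℚ[X] K E B σ z = z := by
      apply hbinj
      rw [hgal]
      exact hσN ⟨_, hzN⟩
    have h1 : ψ (jB β - z) = 0 := by rw [map_sub, hψj, hz, sub_self]
    have h2 : ψ (galRestrict ℚ[X] K E B σ (jB β - z)) = 0 := hσ σ _ h1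
    rw [map_sub, hσz, map_sub, hz, sub_eq_zero] at h2
    let : Algebra ℚ B := ((algebraMap ℚ[X] B).comp C).toAlgebra
    have hβint : IsIntegral ℚ β := (isIntegral_algebraMap_iff (algebraMap L Qbar).injective).1
      (Algebra.IsIntegral.isIntegral (β : Qbar))
    let γ : L →+* B := ((galRestrict ℚ[X] K E B σ : B ≃ₐ[ℚ[X]] B) : B →+* B).comp jB
    have hu : IsIntegral ℚ (γ β - jB β) :=
      (hβint.map γ.toRatAlgHom).sub (hβint.map jB.toRatAlgHom)
    have hu0 : γ β - jB β ≠ 0 := fun h => hσβ <| by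
      rw [← hjB, ← hgal]
      exact congrArg (algebraMap B E) (sub_eq_zero.1 h)
    have hψu : ψ (γ β - jB β) = 0 := by
      rw [map_sub, hψj, sub_eq_zero]
      exact h2
    apply minpoly.coeff_zero_ne_zero hu hu0
    have h3 : ψ.toRatAlgHom (aeval (γ β - jB β) (minpoly ℚ (γ β - jB β))) = 0 := by
      rw [minpoly.aeval, map_zero]
    rw [← aeval_algHom_apply] at h3
    have h4 : ψ.toRatAlgHom (γ β - jB β) = 0 := hψu
    rw [h4, aeval_def, eval₂_at_zero] at h3
    exact (map_eq_zero_iff _ (algebraMap ℚ Qbar).injective).1 h3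

theorem exists_map_algebraMap_eq {L : IntermediateField ℚ Qbar} {g : MvPolynomial (Fin 2) Qbar}
    (hg : ∀ m, g.coeff m ∈ L) : ∃ g', MvPolynomial.map (algebraMap L Qbar) g' = g := by
  refine MvPolynomial.mem_range_map_iff_coeffs_subset.2 fun c hc => ?_
  obtain ⟨m, -, rfl⟩ := MvPolynomial.mem_coeffs_iff.1 hc
  exact ⟨⟨_, hg m⟩, rfl⟩

theorem algebraMap_mem_of_X_mem {K Ω : Type*} [Field K] [Field Ω] [Algebra ℚ[X] K]
    [IsFractionRing ℚ[X] K] [Algebra K Ω] [Algebra ℚ[X] Ω] [IsScalarTower ℚ[X] K Ω] {F : Subfield Ω}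
    (hF : algebraMap ℚ[X] Ω X ∈ F) (k : K) : algebraMap K Ω k ∈ F := by
  have hp : ∀ f : ℚ[X], algebraMap ℚ[X] Ω f ∈ F := fun f => by
    induction f using Polynomial.induction_on' with
    | add p q hp hq => rw [map_add]; exact F.add_mem hp hq
    | monomial n a =>
      rw [← C_mul_X_pow_eq_monomial, map_mul, map_pow]
      refine F.mul_mem ?_ (F.pow_mem hF n)
      have : algebraMap ℚ[X] Ω (C a) = a := eq_ratCast ((algebraMap ℚ[X] Ω).comp C) a
      rw [this]
      exact SubfieldClass.ratCast_mem F a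
  obtain ⟨u, v, -, rfl⟩ := IsFractionRing.div_surjective ℚ[X] k
  rw [map_div₀, ← IsScalarTower.algebraMap_apply, ← IsScalarTower.algebraMap_apply]
  exact F.div_mem (hp u) (hp v)

theorem exists_specialization_of_isAlgClosed {K Ω : Type*} [Field K] [Field Ω] [IsAlgClosed Ω]
    [Algebra Qbar Ω] [Algebra ℚ[X] K] [IsFractionRing ℚ[X] K] [Algebra K Ω] [Algebra ℚ[X] Ω]
    [IsScalarTower ℚ[X] K Ω] {y : Ω} (hy : IsIntegral K y) {T S : Set Qbar} (hT : T.Finite)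
    (hS : S.Finite) (hST : ∀ β ∈ S, algebraMap Qbar Ω β ∉
      Subfield.closure (algebraMap Qbar Ω '' T ∪ {algebraMap ℚ[X] Ω X, y})) :
    ∃ (a b : Qbar),
      (∀ g : MvPolynomial (Fin 2) Qbar, (∀ m, g.coeff m ∈ IntermediateField.adjoin ℚ T) →
        g.eval₂ (algebraMap Qbar Ω) ![algebraMap ℚ[X] Ω X, y] = 0 → g.eval ![a, b] = 0) ∧
      ∀ β ∈ S, β ∉ IntermediateField.adjoin ℚ (T ∪ {a, b}) := by
  have : CharZero K := charZero_of_injective_ringHom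
    (f := (algebraMap ℚ[X] K).comp C) ((IsFractionRing.injective ℚ[X] K).comp C_injective)
  let L := IntermediateField.adjoin ℚ (T ∪ S)
  let E₀ := IntermediateField.adjoin K (algebraMap Qbar Ω '' (T ∪ S) ∪ {y})
  have hcint : ∀ z : Qbar, IsIntegral K (algebraMap Qbar Ω z) := fun z => by
    have hz : IsIntegral ℚ z := Algebra.IsIntegral.isIntegral z
    refine ⟨(minpoly ℚ z).map (algebraMap ℚ K), (minpoly.monic hz).map _, ?_⟩
    have h1 : (algebraMap K Ω).comp (algebraMap ℚ K) =
      (algebraMap Qbar Ω).comp (algebraMap ℚ Qbar) := Subsingleton.elim _ _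
    rw [eval₂_map, h1, ← hom_eval₂, ← aeval_def, minpoly.aeval, map_zero]
  have hfin : FiniteDimensional K E₀ := by
    have : Finite ↑(algebraMap Qbar Ω '' (T ∪ S) ∪ {y}) :=
      (((hT.union hS).image _).union (Set.finite_singleton y)).to_subtype
    refine IntermediateField.finiteDimensional_adjoin ?_
    rintro _ (⟨z, -, rfl⟩ | rfl)
    · exact hcint z
    · exact hy
  let E := IntermediateField.normalClosure K E₀ Ω
  have hE₀ : E₀ ≤ E := IntermediateField.le_normalClosure E₀
  have hE : IsNormalClosure K E₀ E :=
    Algebra.IsAlgebraic.isNormalClosure_normalClosure fun _ => IsAlgClosed.splits _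
  have hEn : Normal K E := hE.normal
  have hEg : IsGalois K E := { }
  have hTS : ∀ z ∈ T ∪ S, algebraMap Qbar Ω z ∈ E := fun z hz =>
    hE₀ (IntermediateField.subset_adjoin _ _ (Or.inl ⟨z, hz, rfl⟩))
  have hL : L ≤ (E.toSubfield.comap (algebraMap Qbar Ω)).toIntermediateField (fun q => by
      rw [eq_ratCast]; exact SubfieldClass.ratCast_mem _ q) :=
    IntermediateField.adjoin_le_iff.2 hTS
  let j : L →+* E := ((algebraMap Qbar Ω).comp (algebraMap L Qbar)).codRestrict E fun l => hL l.2
  let y' : E := ⟨y, hE₀ (IntermediateField.subset_adjoin _ _ (Or.inr rfl))⟩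
  let F := Subfield.closure (algebraMap Qbar Ω '' T ∪ {algebraMap ℚ[X] Ω X, y})
  have hFsub : algebraMap Qbar Ω '' T ∪ {algebraMap ℚ[X] Ω X, y} ⊆ F := Subfield.subset_closure
  let N : IntermediateField K E := (F.comap (algebraMap E Ω)).toIntermediateField fun k =>
    algebraMap_mem_of_X_mem (hFsub (Or.inr (Or.inl rfl))) k
  obtain ⟨a, b, hab, hN⟩ := exists_specialization L j y' N (hFsub (Or.inr (Or.inr rfl))) T
    fun t ht => ⟨IntermediateField.subset_adjoin _ _ (Or.inl ht), hFsub (Or.inl ⟨t, ht, rfl⟩)⟩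
  refine ⟨a, b, fun g hg h0 => ?_, fun β hβ => ?_⟩
  · obtain ⟨g', rfl⟩ := exists_map_algebraMap_eq (L := L) fun m =>
      IntermediateField.adjoin.mono _ _ _ Set.subset_union_left (hg m)
    rw [MvPolynomial.eval_map]
    refine hab g' ?_
    apply (algebraMap E Ω).injective
    rw [MvPolynomial.eval₂_comp_left, map_zero, ← h0, MvPolynomial.eval₂_map]
    congr 1
    ext i; fin_cases i <;> rfl
  · exact hN ⟨β, IntermediateField.subset_adjoin _ _ (Or.inr hβ)⟩ (hST β hβ)

theorem dvd_of_mul_eq_map_sub {k A : Type*} [Field k] [CommRing A] [Algebra k A]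
    {σ : Type*} {f r s : MvPolynomial σ k} {β : A} (hβ : β ∉ (⊥ : Subalgebra k A))
    {w : MvPolynomial σ A} (h : MvPolynomial.map (algebraMap k A) f * w =
      MvPolynomial.map (algebraMap k A) r - MvPolynomial.C β *
        MvPolynomial.map (algebraMap k A) s) :
    f ∣ s := by
  classical
  obtain ⟨φ, hφβ, hφ⟩ := Submodule.exists_le_ker_of_notMem
    (p := Subalgebra.toSubmodule (⊥ : Subalgebra k A)) (v := β) hβ
  have hφ1 : ∀ c : k, φ (algebraMap k A c) = 0 := fun c =>
    hφ ((⊥ : Subalgebra k A).algebraMap_mem c)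
  let w' : MvPolynomial σ k := ∑ m ∈ w.support, MvPolynomial.monomial m (φ (w.coeff m))
  have hw' : ∀ m, w'.coeff m = φ (w.coeff m) := fun m => by
    simp only [w', MvPolynomial.coeff_sum, MvPolynomial.coeff_monomial, Finset.sum_ite_eq',
      MvPolynomial.mem_support_iff]
    split_ifs with hm
    · rfl
    · rw [not_not.1 hm, map_zero]
  have key : f * w' = - MvPolynomial.C (φ β) * s := by
    ext m
    have h2 := congrArg (fun p => φ (MvPolynomial.coeff m p)) h
    simp only [MvPolynomial.coeff_sub, MvPolynomial.coeff_C_mul] at h2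
    rw [MvPolynomial.coeff_mul] at h2
    simp only [MvPolynomial.coeff_map, map_sum, map_sub, hφ1] at h2
    rw [neg_mul, MvPolynomial.coeff_neg, MvPolynomial.coeff_C_mul, MvPolynomial.coeff_mul]
    simp only [hw']
    rw [mul_comm β, ← Algebra.smul_def, map_smul, smul_eq_mul] at h2
    rw [mul_comm (φ β), ← zero_sub (_ * _), ← h2]
    refine Finset.sum_congr rfl fun p _ => ?_
    rw [← Algebra.smul_def, map_smul, smul_eq_mul]
  refine ⟨w' * - MvPolynomial.C (φ β)⁻¹, ?_⟩
  rw [← mul_assoc, key]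
  have : MvPolynomial.C (σ := σ) (φ β) * MvPolynomial.C (φ β)⁻¹ = 1 := by
    rw [← map_mul, mul_inv_cancel₀ hφβ, map_one]
  linear_combination -s * this

theorem algebraMap_notMem_closure {Ω : Type*} [Field Ω] [Algebra Qbar Ω] {v : Fin 2 → Ω}
    {f : MvPolynomial (Fin 2) Qbar} {T : Set Qbar}
    (hfv : ∀ g : MvPolynomial (Fin 2) Qbar, MvPolynomial.aeval v g = 0 ↔ f ∣ g)
    (hfT : ∀ m, f.coeff m ∈ IntermediateField.adjoin ℚ T) {β : Qbar}
    (hβ : β ∉ IntermediateField.adjoin ℚ T) :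
    algebraMap Qbar Ω β ∉ Subfield.closure (algebraMap Qbar Ω '' T ∪ Set.range v) := by
  let k := IntermediateField.adjoin ℚ T
  intro hmem
  have hle : Subfield.closure (algebraMap Qbar Ω '' T ∪ Set.range v) ≤
      (IntermediateField.adjoin k (Set.range v)).toSubfield := by
    refine Subfield.closure_le.2 (Set.union_subset ?_ (IntermediateField.subset_adjoin _ _))
    rintro _ ⟨t, ht, rfl⟩
    exact (IntermediateField.adjoin k (Set.range v)).algebraMap_mem
      ⟨t, IntermediateField.subset_adjoin _ _ ht⟩
  obtain ⟨r, s, hrs⟩ := (IntermediateField.mem_adjoin_range_iff k v _).1 (hle hmem)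
  obtain ⟨f', rfl⟩ := exists_map_algebraMap_eq hfT
  have hs : MvPolynomial.aeval v s ≠ 0 := fun h0 => by
    rw [h0, div_zero, map_eq_zero] at hrs
    exact hβ (hrs ▸ zero_mem _)
  have hae : ∀ p : MvPolynomial (Fin 2) k,
      MvPolynomial.aeval v (MvPolynomial.map (algebraMap k Qbar) p) = MvPolynomial.aeval v p :=
    fun p => MvPolynomial.aeval_map_algebraMap Qbar v p
  obtain ⟨w, hw⟩ := (hfv (MvPolynomial.map (algebraMap k Qbar) r -
      MvPolynomial.C β * MvPolynomial.map (algebraMap k Qbar) s)).1 (by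
    rw [map_sub, map_mul, hae, hae, MvPolynomial.aeval_C, hrs, div_mul_cancel₀ _ hs, sub_self])
  refine hs ?_
  rw [← hae, hfv]
  refine map_dvd _ (dvd_of_mul_eq_map_sub (β := β) ?_ hw.symm)
  rintro ⟨c, rfl⟩
  exact hβ c.2

theorem isAlgebraic_of_transcendental {Ω : Type*} [Field Ω] [Algebra ℚ Ω] [Algebra Qbar Ω]
    {v : Fin 2 → Ω} {f : MvPolynomial (Fin 2) Qbar} (hf : f ≠ 0)
    (hfv : MvPolynomial.aeval v f = 0) (hv : Transcendental ℚ (v 0)) :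
    IsAlgebraic (Algebra.adjoin ℚ {v 0}) (v 1) := by
  by_contra h
  have himage : v '' {1}ᶜ = {v 0} := by
    rw [show ({1}ᶜ : Set (Fin 2)) = {0} by ext i; fin_cases i <;> simp, Set.image_singleton]
  have : AlgebraicIndependent ℚ v := by
    refine (AlgebraicIndependent.iff_transcendental_adjoin_image 1).2 ⟨?_, by rwa [himage]⟩
    have : Subsingleton {j : Fin 2 // j ≠ 1} := ⟨by decide⟩
    exact (algebraicIndependent_singleton_iff ⟨0, by decide⟩).2 hv
  have h2 := (injective_iff_map_eq_zero _).1 (this.extendScalars Qbar)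
  exact hf (h2 f hfv)

theorem exists_zero_of_transcendental {Ω : Type*} [Field Ω] [IsAlgClosed Ω] [Algebra ℚ Ω]
    [Algebra Qbar Ω] {v : Fin 2 → Ω} {f : MvPolynomial (Fin 2) Qbar} (hf : f ≠ 0)
    (hfv : MvPolynomial.aeval v f = 0) (hv : Transcendental ℚ (v 0)) {T S : Set Qbar}
    (hT : T.Finite) (hS : S.Finite) (hfT : ∀ m, f.coeff m ∈ IntermediateField.adjoin ℚ T)
    (hST : ∀ β ∈ S, algebraMap Qbar Ω β ∉
      Subfield.closure (algebraMap Qbar Ω '' T ∪ Set.range v)) :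
    ∃ a b : Qbar, f.eval ![a, b] = 0 ∧ ∀ β ∈ S, β ∉ IntermediateField.adjoin ℚ (T ∪ {a, b}) := by
  have hy := isAlgebraic_of_transcendental hf hfv hv
  let : Algebra ℚ[X] Ω := (aeval (v 0)).toRingHom.toAlgebra
  have hX : algebraMap ℚ[X] Ω X = v 0 := aeval_X (v 0)
  have : FaithfulSMul ℚ[X] Ω :=
    (faithfulSMul_iff_algebraMap_injective _ _).2 (transcendental_iff_injective.1 hv)
  let := FractionRing.liftAlgebra ℚ[X] Ω
  have hy' : IsAlgebraic ℚ[X] (v 1) := by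
    let e : ℚ[X] →ₐ[ℚ] Algebra.adjoin ℚ {v 0} :=
      (aeval (v 0)).codRestrict _ fun p => aeval_mem_adjoin_singleton ℚ (v 0)
    refine IsAlgebraic.of_ringHom_of_comp_eq (S := Algebra.adjoin ℚ {v 0}) (e : ℚ[X] →+* _)
      (RingHom.id Ω) hy ?_ Function.injective_id rfl
    rintro ⟨z, hz⟩
    rw [Algebra.adjoin_singleton_eq_range_aeval] at hz
    obtain ⟨p, rfl⟩ := hz
    exact ⟨p, rfl⟩
  have hyK : IsIntegral (FractionRing ℚ[X]) (v 1) :=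
    isAlgebraic_iff_isIntegral.1 ((IsFractionRing.isAlgebraic_iff ℚ[X] _ Ω).1 hy')
  have hrange : Set.range v = {algebraMap ℚ[X] Ω X, v 1} := by
    rw [hX]; ext z; simp [Fin.exists_fin_two, eq_comm]
  obtain ⟨a, b, hab, hβ⟩ := exists_specialization_of_isAlgClosed hyK hT hS
    (hrange ▸ hST)
  refine ⟨a, b, hab f hfT ?_, hβ⟩
  rw [← hfv, MvPolynomial.aeval_def, hX]
  congr 1
  ext i; fin_cases i <;> rfl

theorem not_dvd_X_sub_C {c : Fin 2 → Qbar} {f : MvPolynomial (Fin 2) Qbar} (hfc : f.eval c = 0)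
    (hf : ∀ i, f ∣ MvPolynomial.X i - MvPolynomial.C (c i)) : False := by
  have key : ∀ i, ∃ u, ∀ j, MvPolynomial.eval c (MvPolynomial.pderiv j f) * u =
      if i = j then 1 else 0 := fun i => by
    obtain ⟨w, hw⟩ := hf i
    refine ⟨w.eval c, fun j => ?_⟩
    have := congrArg (fun p => MvPolynomial.eval c (MvPolynomial.pderiv j p)) hw
    simpa [MvPolynomial.pderiv_mul, hfc, MvPolynomial.pderiv_X, Pi.single_apply,
      apply_ite (MvPolynomial.eval c), @eq_comm _ j, mul_comm] using this.symm
  obtain ⟨u, hu⟩ := key 0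
  obtain ⟨w, hw⟩ := key 1
  obtain h | h := mul_eq_zero.1 ((hu 1).trans (if_neg zero_ne_one))
  · simpa [h] using hw 1
  · simpa [h] using hu 0

theorem exists_generic_point {f : MvPolynomial (Fin 2) Qbar} (hf : Irreducible f) :
    ∃ (Ω : Type) (_ : Field Ω) (_ : IsAlgClosed Ω) (_ : Algebra Qbar Ω) (v : Fin 2 → Ω),
      ∀ g : MvPolynomial (Fin 2) Qbar, MvPolynomial.aeval v g = 0 ↔ f ∣ g := by
  have : (Ideal.span {f}).IsPrime := (Ideal.span_singleton_prime hf.ne_zero).2 hf.prime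
  let A := MvPolynomial (Fin 2) Qbar ⧸ Ideal.span {f}
  let φ : A →ₐ[Qbar] AlgebraicClosure (FractionRing A) := IsScalarTower.toAlgHom _ _ _
  have hφ : Function.Injective φ :=
    (algebraMap (FractionRing A) _).injective.comp (IsFractionRing.injective A _)
  refine ⟨AlgebraicClosure (FractionRing A), inferInstance, inferInstance, inferInstance,
    fun i => φ (Ideal.Quotient.mk _ (MvPolynomial.X i)), fun g => ?_⟩
  have : MvPolynomial.aeval (fun i => φ (Ideal.Quotient.mk _ (MvPolynomial.X i))) =
      φ.comp (Ideal.Quotient.mkₐ Qbar (Ideal.span {f})) :=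
    MvPolynomial.algHom_ext fun i => by simp; rfl
  rw [this, AlgHom.comp_apply, map_eq_zero_iff φ hφ, Ideal.Quotient.mkₐ_eq_mk,
    Ideal.Quotient.eq_zero_iff_mem, Ideal.mem_span_singleton]

theorem exists_zero_avoiding {f : MvPolynomial (Fin 2) Qbar} (hf : Irreducible f)
    {T S : Set Qbar} (hT : T.Finite) (hS : S.Finite)
    (hfT : ∀ m, f.coeff m ∈ IntermediateField.adjoin ℚ T)
    (hST : ∀ β ∈ S, β ∉ IntermediateField.adjoin ℚ T) :
    ∃ a b : Qbar, f.eval ![a, b] = 0 ∧ ∀ β ∈ S, β ∉ IntermediateField.adjoin ℚ (T ∪ {a, b}) := by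
  obtain ⟨Ω, _, _, _, v, hfv⟩ := exists_generic_point hf
  have : CharZero Ω := charZero_of_injective_ringHom (algebraMap Qbar Ω).injective
  have hST' := fun β hβ => algebraMap_notMem_closure hfv hfT (hST β hβ)
  have h0 : MvPolynomial.aeval v f = 0 := (hfv f).2 dvd_rfl
  by_cases h : Transcendental ℚ (v 0)
  · exact exists_zero_of_transcendental hf.ne_zero h0 h hT hS hfT hST'
  by_cases h' : Transcendental ℚ (v 1)
  · obtain ⟨f', rfl⟩ := exists_map_algebraMap_eq hfT
    have hfT' : ∀ m, (MvPolynomial.rename (Equiv.swap (0 : Fin 2) 1)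
        (MvPolynomial.map (algebraMap (IntermediateField.adjoin ℚ T) Qbar) f')).coeff m ∈
        IntermediateField.adjoin ℚ T := fun m => by
      rw [← MvPolynomial.map_rename, MvPolynomial.coeff_map]
      exact Subtype.coe_prop _
    obtain ⟨a, b, hab, hβ⟩ := exists_zero_of_transcendental
      (v := v ∘ Equiv.swap 0 1) (f := MvPolynomial.rename (Equiv.swap 0 1)
        (MvPolynomial.map (algebraMap (IntermediateField.adjoin ℚ T) Qbar) f'))
      (fun h => hf.ne_zero (MvPolynomial.rename_injective _ (Equiv.injective _)
        (h.trans (map_zero _).symm))) (by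
        rw [MvPolynomial.aeval_rename, ← h0]
        congr 2
        ext i; simp) (by simpa using h') hT hS hfT' (by simpa using hST')
    refine ⟨b, a, ?_, by rwa [Set.pair_comm]⟩
    rw [MvPolynomial.eval_rename] at hab
    rw [← hab]
    congr 2
    ext i; fin_cases i <;> simp
  · exfalso
    have hc : ∀ i, ∃ c, algebraMap Qbar Ω c = v i := fun i => by
      have hi : IsAlgebraic ℚ (v i) := by
        fin_cases i
        · exact not_not.1 h
        · exact not_not.1 h'
      have hi' : IsIntegral Qbar (v i) := (isAlgebraic_iff_isIntegral.1 hi).tower_top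
      exact minpoly.mem_range_of_degree_eq_one Qbar _
        (IsAlgClosed.degree_eq_one_of_irreducible _ (minpoly.irreducible hi'))
    choose c hc using hc
    have hv : v = algebraMap Qbar Ω ∘ c := funext fun i => (hc i).symm
    refine not_dvd_X_sub_C (c := c) ?_ fun i => (hfv _).1 (by simp [hc])
    apply (algebraMap Qbar Ω).injective
    rw [map_zero, ← h0, hv, MvPolynomial.aeval_def, MvPolynomial.eval₂_comp]

theorem exists_seq_avoiding {T₀ S : Set Qbar} (hT₀ : T₀.Finite) (hS : S.Finite)
    (hST : ∀ β ∈ S, β ∉ IntermediateField.adjoin ℚ T₀) (p : ℕ → MvPolynomial (Fin 2) Qbar) :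
    ∃ T : ℕ → Set Qbar, T 0 = T₀ ∧ Monotone T ∧
      (∀ n, ∀ β ∈ S, β ∉ IntermediateField.adjoin ℚ (T n)) ∧
      ∀ n, Irreducible (p n) → (∀ m, (p n).coeff m ∈ IntermediateField.adjoin ℚ (T n)) →
        ∃ a ∈ T (n + 1), ∃ b ∈ T (n + 1), (p n).eval ![a, b] = 0 := by
  let P : Set Qbar → Prop := fun T => T.Finite ∧ ∀ β ∈ S, β ∉ IntermediateField.adjoin ℚ T
  have step : ∀ (f : MvPolynomial (Fin 2) Qbar) (T : {T // P T}), ∃ T' : {T // P T},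
      T.1 ⊆ T'.1 ∧ (Irreducible f → (∀ m, f.coeff m ∈ IntermediateField.adjoin ℚ T.1) →
        ∃ a ∈ T'.1, ∃ b ∈ T'.1, f.eval ![a, b] = 0) := by
    rintro f ⟨T, hT, hTS⟩
    by_cases h : Irreducible f ∧ ∀ m, f.coeff m ∈ IntermediateField.adjoin ℚ T
    · obtain ⟨a, b, hab, hβ⟩ := exists_zero_avoiding h.1 hT hS h.2 hTS
      exact ⟨⟨T ∪ {a, b}, hT.union (Set.toFinite _), hβ⟩, Set.subset_union_left,
        fun _ _ => ⟨a, by simp, b, by simp, hab⟩⟩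
    · exact ⟨⟨T, hT, hTS⟩, subset_rfl, fun h1 h2 => (h ⟨h1, h2⟩).elim⟩
  choose next hTsub hnext using step
  let T : ℕ → {T // P T} := Nat.rec ⟨T₀, hT₀, hST⟩ fun n => next (p n)
  exact ⟨fun n => (T n).1, rfl, monotone_nat_of_le_succ fun n => hTsub (p n) (T n),
    fun n => (T n).2.2, fun n => hnext (p n) (T n)⟩

theorem exists_isPAC_superset_avoiding {A S : Set Qbar} (hA : A.Finite) (hS : S.Finite)
    (hAS : ∀ β ∈ S, β ∉ IntermediateField.adjoin ℚ A) :
    ∃ F : Subfield Qbar, IsPAC F ∧ A ⊆ F ∧ ∀ β ∈ S, β ∉ F := by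
  have : Countable Qbar :=
    Cardinal.mk_le_aleph0_iff.1 (by simpa using Algebra.IsAlgebraic.cardinalMk_le_max ℚ Qbar)
  have : Countable (MvPolynomial (Fin 2) Qbar) := AddMonoidAlgebra.coeff_injective.countable
  obtain ⟨e, he⟩ := exists_surjective_nat (MvPolynomial (Fin 2) Qbar)
  obtain ⟨T, hT0, hT, hTS, hzero⟩ := exists_seq_avoiding hA hS hAS fun n => e (Nat.unpair n).1
  have hmono : Monotone fun n => (IntermediateField.adjoin ℚ (T n)).toSubfield :=
    fun m n h => IntermediateField.adjoin.mono _ _ _ (hT h)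
  let F : Subfield Qbar := ⨆ n, (IntermediateField.adjoin ℚ (T n)).toSubfield
  have hF : ∀ z, z ∈ F ↔ ∃ n, z ∈ IntermediateField.adjoin ℚ (T n) := fun z =>
    Subfield.mem_iSup_of_directed hmono.directed_le
  have hTF : ∀ n, T n ⊆ F := fun n z hz =>
    (hF z).2 ⟨n, IntermediateField.subset_adjoin _ _ hz⟩
  refine ⟨F, fun f hf => ?_, hT0 ▸ hTF 0, fun β hβ h => ?_⟩
  · have hbound : ∃ N, ∀ m, ((f.coeff m : F) : Qbar) ∈ IntermediateField.adjoin ℚ (T N) := by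
      choose n hn using fun m => (hF (f.coeff m : F)).1 (f.coeff m).2
      refine ⟨f.support.sup n, fun m => ?_⟩
      by_cases hm : m ∈ f.support
      · exact hmono (Finset.le_sup hm) (hn m)
      · rw [MvPolynomial.notMem_support_iff.1 hm]
        exact zero_mem _
    obtain ⟨N, hN⟩ := hbound
    obtain ⟨i, hi⟩ := he (MvPolynomial.map F.subtype f)
    have hp : e (Nat.unpair (Nat.pair i N)).1 = MvPolynomial.map F.subtype f := by
      rw [Nat.unpair_pair, hi]
    obtain ⟨a, ha, b, hb, hab⟩ := hzero (Nat.pair i N) (hp ▸ hf) fun m => by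
      rw [hp, MvPolynomial.coeff_map]
      exact hmono (Nat.right_le_pair i N) (hN m)
    refine ⟨⟨a, hTF _ ha⟩, ⟨b, hTF _ hb⟩, F.subtype_injective ?_⟩
    rw [map_zero, ← hab, hp, MvPolynomial.eval_map, ← MvPolynomial.eval₂_id,
      MvPolynomial.eval₂_comp_left, RingHom.comp_id]
    congr 1
    ext i; fin_cases i <;> rfl
  · obtain ⟨n, hn⟩ := (hF β).1 h
    exact hTS n β hβ hn

theorem exists_finset_subset_of_mem_nhds {F : Subfield Qbar} {U : Set (Subfield Qbar)}
    (hU : U ∈ 𝓝 F) :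
    ∃ I : Set Qbar, I.Finite ∧ ∀ F' : Subfield Qbar, (∀ z ∈ I, z ∈ F' ↔ z ∈ F) → F' ∈ U := by
  let := propDiscrete
  obtain ⟨V, hV, hVU⟩ := (@mem_nhds_induced _ _ powersetTopology _ F U).1 hU
  have hV' : V ∈ 𝓝 (fun z : Qbar => z ∈ F) := hV
  rw [nhds_pi] at hV'
  obtain ⟨I, hI, t, ht, hIt⟩ := Filter.mem_pi.1 hV'
  refine ⟨I, hI, fun F' hF' => hVU (hIt fun z hz => ?_)⟩
  have : (z ∈ F') = (z ∈ F) := propext (hF' z hz)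
  have h2 := @mem_of_mem_nhds _ propDiscrete _ _ (ht z)
  change (z ∈ F') ∈ t z
  rw [this]
  exact h2

/-- The set of PAC subfields of `Q̄` is dense in the space `𝓔` of all subfields of `Q̄`. -/
theorem pac_dense : Dense {F : Subfield Qbar | IsPAC F} := by
  intro F
  refine mem_closure_iff_nhds.2 fun U hU => ?_
  obtain ⟨I, hI, hIU⟩ := exists_finset_subset_of_mem_nhds hU
  have hle : IntermediateField.adjoin ℚ (I ∩ F) ≤
      F.toIntermediateField fun q => by rw [eq_ratCast]; exact SubfieldClass.ratCast_mem F q :=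
    IntermediateField.adjoin_le_iff.2 fun z hz => hz.2
  obtain ⟨F', hF', hTsub, havoid⟩ := exists_isPAC_superset_avoiding (A := I ∩ F) (S := I \ F)
    (hI.inter_of_left _) hI.sdiff fun β hβ h => hβ.2 (hle h)
  refine ⟨F', hIU F' fun z hz => ⟨fun h => ?_, fun h => hTsub ⟨hz, h⟩⟩, hF'⟩
  by_contra hzF
  exact havoid z ⟨hz, hzF⟩ h
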